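/- (Key a priori estimate for the corrector.) Assume V ∈ C^∞(𝕋^d). Fix i ∈ {1,…,m} and a unit vector e ∈ ℝ^d, and suppose g ∈ C^∞(X), with g and all its partial derivatives in L²(μ_β), solves 𝓛 g = −(α_i/λ_i) z_i·e pointwise on X. Then ‖∇_{z_i} g‖_{L²(μ_β)} ≤ 1/λ_i. -/

import Mathlib

open MeasureTheory Real Filter

noncomputable section

/-- The state space `X = 𝕋^d × ℝ^d × ℝ^{dm}`, realised as
`ℝ^d × ℝ^d × (ℝ^d)^m` with functions that are `ℤ^d`-periodic in the first variable. -/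
abbrev Xsp (d m : ℕ) := (Fin d → ℝ) × (Fin d → ℝ) × (Fin m → Fin d → ℝ)

/-- The direction in the `z_j`-block given by the vector `v`. -/
def zdir (d m : ℕ) (j : Fin m) (v : Fin d → ℝ) : Xsp d m :=
  (0, 0, Function.update 0 j v)

/-- The partial derivative `∂_{z_{j,k}} φ`. -/
def pZ (d m : ℕ) (j : Fin m) (k : Fin d) (φ : Xsp d m → ℝ) (x : Xsp d m) : ℝ :=
  fderiv ℝ φ x (zdir d m j (Pi.single k 1))

/-- The partial derivative `∂_{p_k} φ`. -/
def pP (d m : ℕ) (k : Fin d) (φ : Xsp d m → ℝ) (x : Xsp d m) : ℝ :=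
  fderiv ℝ φ x (0, Pi.single k 1, 0)

/-- The partial derivative `∂_{q_k} φ`. -/
def pQ (d m : ℕ) (k : Fin d) (φ : Xsp d m → ℝ) (x : Xsp d m) : ℝ :=
  fderiv ℝ φ x (Pi.single k 1, 0, 0)

/-- The operator `𝓛` (negative of the generator of the Markovian GLE dynamics):
`𝓛φ = −p·∇_qφ + ∇V·∇_pφ − Σ_j λ_j z_j·∇_pφ + Σ_j λ_j p·∇_{z_j}φ
      + Σ_j α_j z_j·∇_{z_j}φ − β⁻¹ Σ_j α_j Δ_{z_j}φ`. -/
def gen (d m : ℕ) (β : ℝ) (α lam : Fin m → ℝ) (V : (Fin d → ℝ) → ℝ)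
    (φ : Xsp d m → ℝ) (x : Xsp d m) : ℝ :=
  - fderiv ℝ φ x (x.2.1, 0, 0)
  + fderiv ℝ φ x (0, (fun i => fderiv ℝ V x.1 (Pi.single i 1)), 0)
  - fderiv ℝ φ x (0, ∑ j, lam j • x.2.2 j, 0)
  + ∑ j, lam j * fderiv ℝ φ x (zdir d m j x.2.1)
  + ∑ j, α j * fderiv ℝ φ x (zdir d m j (x.2.2 j))
  - β⁻¹ * ∑ j, α j * ∑ k, fderiv ℝ (pZ d m j k φ) x (zdir d m j (Pi.single k 1))

/-- The (unnormalised) Gibbs density `exp(−β(V(q) + |p|²/2 + |z|²/2))`. -/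
def gdens (d m : ℕ) (β : ℝ) (V : (Fin d → ℝ) → ℝ) (x : Xsp d m) : ℝ :=
  Real.exp (-β * (V x.1 + (∑ i, (x.2.1 i) ^ 2) / 2 + (∑ j, ∑ i, (x.2.2 j i) ^ 2) / 2))

/-- The fundamental domain `[0,1)^d` for the torus in the `q`-variable. -/
def cube (d : ℕ) : Set (Fin d → ℝ) := {q | ∀ i, q i ∈ Set.Ico (0 : ℝ) 1}

/-- Lebesgue measure on `X = 𝕋^d × ℝ^d × ℝ^{dm}` (the `q`-variable being
restricted to a fundamental domain of the torus). -/
def volX (d m : ℕ) : Measure (Xsp d m) :=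
  (volume : Measure (Xsp d m)).restrict {x | x.1 ∈ cube d}

/-- The Gibbs measure `μ_β`, with density `Z⁻¹ exp(−β(V(q)+|p|²/2+|z|²/2))`. -/
def gibbs (d m : ℕ) (β Z : ℝ) (V : (Fin d → ℝ) → ℝ) : Measure (Xsp d m) :=
  (volX d m).withDensity fun x => ENNReal.ofReal (Z⁻¹ * gdens d m β V x)

/-- `ℤ^d`-periodicity in the `q`-variable. -/
def PerQ (d m : ℕ) (φ : Xsp d m → ℝ) : Prop :=
  ∀ (k : Fin d → ℤ) (x : Xsp d m), φ (x.1 + (fun i => (k i : ℝ)), x.2) = φ x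

/-- `ℤ^d`-periodicity of the potential. -/
def PerV (d : ℕ) (V : (Fin d → ℝ) → ℝ) : Prop :=
  ∀ (k : Fin d → ℤ) (q : Fin d → ℝ), V (q + fun i => (k i : ℝ)) = V q

/-- A test function: smooth, periodic in `q`, compactly supported in `(p,z)`. -/
def IsTest (d m : ℕ) (φ : Xsp d m → ℝ) : Prop :=
  ContDiff ℝ (⊤ : ℕ∞) φ ∧ PerQ d m φ ∧
    ∃ K : Set ((Fin d → ℝ) × (Fin m → Fin d → ℝ)),
      IsCompact K ∧ ∀ x : Xsp d m, x.2 ∉ K → φ x = 0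

theorem PerQ.fderiv {d m : ℕ} {φ : Xsp d m → ℝ} (h : PerQ d m φ) (v : Xsp d m) :
    PerQ d m (fun x => fderiv ℝ φ x v) := by
  intro k x
  have hφ : (fun y : Xsp d m => φ (y + ((fun i => (k i : ℝ)), 0))) = φ := by
    funext y
    rw [← h k y]
    congr 1
    ext <;> simp
  have hx : ((x.1 + (fun i => (k i : ℝ)), x.2) : Xsp d m) = x + ((fun i => (k i : ℝ)), 0) := by
    ext <;> simp
  simp only [hx]
  rw [← fderiv_comp_add_right, hφ]

theorem IsTest.fderiv {d m : ℕ} {φ : Xsp d m → ℝ} (h : IsTest d m φ) (v : Xsp d m) :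
    IsTest d m (fun x => fderiv ℝ φ x v) := by
  obtain ⟨hs, hp, K, hK, h0⟩ := h
  refine ⟨(hs.fderiv_right (m := (⊤ : ℕ∞)) (by simp)).clm_apply contDiff_const,
    hp.fderiv v, K, hK, fun x hx => ?_⟩
  have hev : φ =ᶠ[nhds x] fun _ => (0 : ℝ) := by
    filter_upwards [(hK.isClosed.isOpen_compl.preimage continuous_snd).mem_nhds hx] with y hy
    exact h0 y hy
  simp [hev.fderiv_eq]

theorem IsTest.mul_left {d m : ℕ} {φ ψ : Xsp d m → ℝ} (h : IsTest d m φ)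
    (hψ : ContDiff ℝ (⊤ : ℕ∞) ψ) (hp : PerQ d m ψ) : IsTest d m (fun x => ψ x * φ x) := by
  obtain ⟨hs, hq, K, hK, h0⟩ := h
  exact ⟨hψ.mul hs, fun k x => by simp only [hp k x, hq k x], K, hK,
    fun x hx => by simp [h0 x hx]⟩

theorem IsTest.bounded {d m : ℕ} {φ : Xsp d m → ℝ} (h : IsTest d m φ) :
    ∃ M, ∀ x, ‖φ x‖ ≤ M := by
  obtain ⟨hs, hq, K, hK, h0⟩ := h
  have hc : IsCompact ((Set.Icc (0 : Fin d → ℝ) 1) ×ˢ K) := isCompact_Icc.prod hK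
  obtain ⟨M, hM⟩ := hc.exists_bound_of_continuousOn hs.continuous.continuousOn
  refine ⟨max M 0, fun x => ?_⟩
  by_cases hx : x.2 ∈ K
  · rw [← hq (fun i => -⌊x.1 i⌋) x]
    refine (hM (x.1 + _, x.2) ⟨⟨fun i => ?_, fun i => ?_⟩, hx⟩).trans (le_max_left _ _)
    · simpa using Int.floor_le (x.1 i)
    · have := Int.lt_floor_add_one (x.1 i)
      simp only [Pi.add_apply, Int.cast_neg, Pi.one_apply]
      linarith
  · simp [h0 x hx]

theorem volX_slab_lt_top (d m : ℕ) (r : ℝ) :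
    volX d m {x | x.2 ∈ Metric.closedBall 0 r} < ⊤ := by
  have hms : MeasurableSet {x : Xsp d m | x.2 ∈ Metric.closedBall 0 r} :=
    measurable_snd Metric.isClosed_closedBall.measurableSet
  rw [volX, Measure.restrict_apply hms]
  refine lt_of_le_of_lt (measure_mono (t := Set.Icc (0 : Fin d → ℝ) 1 ×ˢ Metric.closedBall 0 r)
    ?_) (isCompact_Icc.prod (isCompact_closedBall _ _)).measure_lt_top
  rintro x ⟨hx, hc⟩
  exact ⟨⟨fun i => (hc i).1, fun i => (hc i).2.le⟩, hx⟩

theorem integrable_volX_slab (d m : ℕ) (r M : ℝ) :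
    Integrable ({x : Xsp d m | x.2 ∈ Metric.closedBall 0 r}.indicator fun _ => M)
      (volX d m) := by
  have hms : MeasurableSet {x : Xsp d m | x.2 ∈ Metric.closedBall 0 r} :=
    measurable_snd Metric.isClosed_closedBall.measurableSet
  rw [integrable_indicator_iff hms]
  exact integrableOn_const (volX_slab_lt_top d m r).ne

theorem IsTest.exists_radius {d m : ℕ} {φ : Xsp d m → ℝ} (h : IsTest d m φ) :
    ∃ r, ∀ x : Xsp d m, x.2 ∉ Metric.closedBall 0 r → φ x = 0 := by
  obtain ⟨-, -, K, hK, h0⟩ := h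
  obtain ⟨r, hr⟩ := hK.isBounded.subset_closedBall 0
  exact ⟨r, fun x hx => h0 x fun hk => hx (hr hk)⟩

theorem IsTest.integrable {d m : ℕ} {φ : Xsp d m → ℝ} (h : IsTest d m φ) :
    Integrable φ (volX d m) := by
  obtain ⟨M, hM⟩ := h.bounded
  obtain ⟨r, hr⟩ := h.exists_radius
  refine (integrable_volX_slab d m r M).mono' h.1.continuous.aestronglyMeasurable
    (Eventually.of_forall fun x => ?_)
  by_cases hx : x.2 ∈ Metric.closedBall 0 r
  · rw [Set.indicator_of_mem (by exact hx)]
    exact hM x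
  · rw [Set.indicator_of_notMem (by exact hx), hr x hx, norm_zero]

theorem volX_eq_prod (d m : ℕ) :
    volX d m = (volume.restrict (cube d)).prod volume := by
  have : {x : Xsp d m | x.1 ∈ cube d} = cube d ×ˢ Set.univ := by ext; simp
  rw [volX, this, Measure.volume_eq_prod, ← Measure.prod_restrict, Measure.restrict_univ]

open scoped Pointwise in
theorem setIntegral_cube_add {d : ℕ} (f : (Fin d → ℝ) → ℝ)
    (hf : ∀ (k : Fin d → ℤ) q, f (q + fun i => (k i : ℝ)) = f q) (a : Fin d → ℝ) :
    ∫ q in cube d, f (q + a) = ∫ q in cube d, f q := by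
  set b := Pi.basisFun ℝ (Fin d)
  set G := (Submodule.span ℤ (Set.range b)).toAddSubgroup
  have hcube : cube d = ZSpan.fundamentalDomain b := by
    ext q; simp [cube, b]
  have : VAddInvariantMeasure G (Fin d → ℝ) volume :=
    inferInstanceAs <| VAddInvariantMeasure (Submodule.span ℤ (Set.range b)).toAddSubgroup _ _
  have hfd : IsAddFundamentalDomain G (cube d) (volume : Measure (Fin d → ℝ)) := by
    rw [hcube]; exact ZSpan.isAddFundamentalDomain' b volume
  have : Countable G := inferInstanceAs (Countable (Submodule.span ℤ (Set.range b)))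
  have hfd' := hfd.vadd_of_comm a
  have hinv : ∀ (g : G) (x : Fin d → ℝ), f (g +ᵥ x) = f x := by
    rintro ⟨g, hg⟩ x
    have hsplit : ∀ i, ∃ n : ℤ, (n : ℝ) = g i := by
      intro i
      simpa [b] using (b.mem_span_iff_repr_mem ℤ g).1 hg i
    choose k hk using hsplit
    have hgk : g = fun i => (k i : ℝ) := funext fun i => (hk i).symm
    have : ((⟨g, hg⟩ : G) +ᵥ x) = x + g := add_comm _ _
    rw [this, hgk, hf]
  rw [hfd.setIntegral_eq hfd' hinv]
  have himg : a +ᵥ cube d = (fun q => q + a) '' cube d := by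
    ext q
    simp only [Set.mem_vadd_set, Set.mem_image, vadd_eq_add, add_comm a]
  rw [himg, (measurePreserving_add_right volume a).setIntegral_image_emb
    (measurableEmbedding_addRight a)]

theorem IsTest.integral_add {d m : ℕ} {φ : Xsp d m → ℝ} (h : IsTest d m φ) (v : Xsp d m) :
    ∫ x, φ (x + v) ∂(volX d m) = ∫ x, φ x ∂(volX d m) := by
  have hshift : IsTest d m (fun x => φ (x + v)) := by
    obtain ⟨hs, hq, K, hK, h0⟩ := h
    refine ⟨hs.comp (contDiff_id.add contDiff_const), fun k x => ?_,
      (fun y => y - v.2) '' K, hK.image (continuous_id.sub continuous_const), fun x hx => ?_⟩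
    · refine Eq.trans ?_ (hq k (x + v))
      change φ _ = φ _
      congr 1
      ext <;> simp; ring
    · exact h0 _ fun hk => hx ⟨_, hk, by simp⟩
  have h1 := hshift.integrable
  have h2 := h.integrable
  rw [volX_eq_prod] at h1 h2 ⊢
  rw [integral_prod _ h1, integral_prod _ h2]
  rw [← setIntegral_cube_add (fun q => ∫ y, φ (q, y)) _ v.1]
  · have : (volume : Measure ((Fin d → ℝ) × (Fin m → Fin d → ℝ))).IsAddRightInvariant := by
      rw [Measure.volume_eq_prod]
      have : (volume : Measure (Fin m → Fin d → ℝ)).IsAddLeftInvariant := inferInstance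
      have : ((volume : Measure (Fin d → ℝ)).prod
        (volume : Measure (Fin m → Fin d → ℝ))).IsAddLeftInvariant := inferInstance
      infer_instance
    refine integral_congr_ae (Eventually.of_forall fun q => ?_)
    exact integral_add_right_eq_self (fun y => φ (q + v.1, y)) v.2
  · intro k q
    refine integral_congr_ae (Eventually.of_forall fun y => ?_)
    exact h.2.1 k (q, y)

theorem IsTest.integral_fderiv {d m : ℕ} {φ : Xsp d m → ℝ} (h : IsTest d m φ) (v : Xsp d m) :
    ∫ x, _root_.fderiv ℝ φ x v ∂(volX d m) = 0 := by
  obtain ⟨M, hM⟩ := (h.fderiv v).bounded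
  obtain ⟨r, hr⟩ := (h.fderiv v).exists_radius
  have hM0 : 0 ≤ M := (norm_nonneg _).trans (hM 0)
  have hline : ∀ (x : Xsp d m) (t : ℝ),
      HasDerivAt (fun s : ℝ => φ (x + s • v)) (_root_.fderiv ℝ φ (x + t • v) v) t := by
    intro x t
    have h1 : HasDerivAt (fun s : ℝ => x + s • v) v t := by
      simpa using ((hasDerivAt_id t).smul_const v).const_add x
    exact ((h.1.differentiable (by simp)) _).hasFDerivAt.comp_hasDerivAt t h1
  have key := hasDerivAt_integral_of_dominated_loc_of_deriv_le (μ := volX d m) (x₀ := (0 : ℝ))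
    (F := fun t x => φ (x + t • v)) (F' := fun t x => _root_.fderiv ℝ φ (x + t • v) v)
    (bound := {x : Xsp d m | x.2 ∈ Metric.closedBall 0 (r + ‖v‖)}.indicator fun _ => M)
    (Metric.ball_mem_nhds 0 one_pos)
    (Eventually.of_forall fun t =>
      (h.1.continuous.comp (continuous_add_const (t • v))).aestronglyMeasurable)
    (by simpa using h.integrable)
    (by simpa using (h.fderiv v).1.continuous.aestronglyMeasurable)
    (Eventually.of_forall fun x t ht => by
      by_cases hx : x.2 ∈ Metric.closedBall 0 (r + ‖v‖)
      · rw [Set.indicator_of_mem (by exact hx)]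
        exact hM _
      · rw [Set.indicator_of_notMem (by exact hx), hr, norm_zero]
        intro hc
        apply hx
        rw [mem_closedBall_zero_iff] at hc ⊢
        rw [mem_ball_zero_iff] at ht
        have e1 : x.2 = (x + t • v).2 - t • v.2 := by simp
        have e2 : ‖t • v.2‖ ≤ ‖v‖ := by
          rw [norm_smul]
          calc ‖t‖ * ‖v.2‖ ≤ 1 * ‖v‖ :=
                mul_le_mul ht.le (norm_snd_le v) (norm_nonneg _) zero_le_one
            _ = ‖v‖ := one_mul _
        rw [e1]
        exact (norm_sub_le _ _).trans (add_le_add hc e2))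
    (integrable_volX_slab d m _ M)
    (Eventually.of_forall fun x t _ => hline x t)
  have hconst : (fun t : ℝ => ∫ x, φ (x + t • v) ∂(volX d m)) = fun _ => ∫ x, φ x ∂(volX d m) :=
    funext fun t => h.integral_add (t • v)
  have h2 := key.2
  rw [hconst] at h2
  simpa using h2.unique (hasDerivAt_const (0 : ℝ) _)

/-- `f` is integrable with zero integral. -/
def IntegralZero {X : Type*} [MeasurableSpace X] (μ : Measure X) (f : X → ℝ) : Prop :=
  Integrable f μ ∧ ∫ x, f x ∂μ = 0

namespace IntegralZero

variable {X : Type*} [MeasurableSpace X] {μ : Measure X} {f f' : X → ℝ}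

theorem add (h : IntegralZero μ f) (h' : IntegralZero μ f') :
    IntegralZero μ (fun x => f x + f' x) :=
  ⟨h.1.add h'.1, by rw [integral_add h.1 h'.1, h.2, h'.2, add_zero]⟩

theorem const_mul (h : IntegralZero μ f) (c : ℝ) : IntegralZero μ (fun x => c * f x) :=
  ⟨h.1.const_mul c, by rw [integral_const_mul, h.2, mul_zero]⟩

theorem neg (h : IntegralZero μ f) : IntegralZero μ (fun x => - f x) :=
  ⟨h.1.neg, by rw [integral_neg, h.2, neg_zero]⟩

theorem sub (h : IntegralZero μ f) (h' : IntegralZero μ f') :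
    IntegralZero μ (fun x => f x - f' x) :=
  ⟨h.1.sub h'.1, by rw [integral_sub h.1 h'.1, h.2, h'.2, sub_zero]⟩

theorem sum {ι : Type*} (s : Finset ι) {F : ι → X → ℝ} (h : ∀ i ∈ s, IntegralZero μ (F i)) :
    IntegralZero μ (fun x => ∑ i ∈ s, F i x) :=
  ⟨integrable_finsetSum s fun i hi => (h i hi).1, by
    rw [integral_finsetSum s fun i hi => (h i hi).1]
    exact Finset.sum_eq_zero fun i hi => (h i hi).2⟩

end IntegralZero

theorem fderiv_mul_apply_dir {E : Type*} [NormedAddCommGroup E] [NormedSpace ℝ E] {f g : E → ℝ}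
    {x : E} (hf : DifferentiableAt ℝ f x) (hg : DifferentiableAt ℝ g x) (v : E) :
    fderiv ℝ (fun y => f y * g y) x v = fderiv ℝ f x v * g x + f x * fderiv ℝ g x v := by
  rw [fderiv_fun_mul hf hg]
  simp [mul_comm, add_comm]

theorem fderiv_apply_eq_zero_of_forall_add_smul {E : Type*} [NormedAddCommGroup E]
    [NormedSpace ℝ E] {c : E → ℝ} (hc : Differentiable ℝ c) {v : E}
    (h : ∀ x (t : ℝ), c (x + t • v) = c x) (x : E) : fderiv ℝ c x v = 0 := by
  have h1 : HasDerivAt (fun t : ℝ => x + t • v) v 0 := by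
    simpa using ((hasDerivAt_id (0 : ℝ)).smul_const v).const_add x
  have h2 : HasFDerivAt c (fderiv ℝ c x) (x + (0 : ℝ) • v) := by
    simpa using (hc x).hasFDerivAt
  have h3 := h2.comp_hasDerivAt (0 : ℝ) h1
  have h4 : (c ∘ fun t : ℝ => x + t • v) = fun _ => c x := funext fun t => h x t
  rw [h4] at h3
  exact h3.unique (hasDerivAt_const _ _)

/-- Integration by parts against a coefficient which is constant in the direction of
differentiation. -/
theorem IsTest.integralZero_mul_fderiv {d m : ℕ} {φ : Xsp d m → ℝ} (h : IsTest d m φ)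
    {c : Xsp d m → ℝ} (hc : ContDiff ℝ (⊤ : ℕ∞) c) (hp : PerQ d m c) {v : Xsp d m}
    (hv : ∀ x (t : ℝ), c (x + t • v) = c x) :
    IntegralZero (volX d m) (fun x => c x * _root_.fderiv ℝ φ x v) := by
  have ht := h.mul_left hc hp
  have hdc : Differentiable ℝ c := hc.differentiable (by simp)
  have heq : (fun x => c x * _root_.fderiv ℝ φ x v)
      = fun x => _root_.fderiv ℝ (fun y => c y * φ y) x v := by
    funext x
    rw [fderiv_mul_apply_dir (hdc x) (h.1.differentiable (by simp) x),
      fderiv_apply_eq_zero_of_forall_add_smul hdc hv]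
    ring
  rw [heq]
  exact ⟨(ht.fderiv v).integrable, ht.integral_fderiv v⟩

theorem LinearMap.apply_eq_sum_single {d : ℕ} (L : (Fin d → ℝ) →ₗ[ℝ] ℝ) (v : Fin d → ℝ) :
    L v = ∑ k, v k * L (Pi.single k 1) := by
  conv_lhs => rw [← (Pi.basisFun ℝ (Fin d)).sum_repr v]
  simp

section Coordinates

variable {d m : ℕ} (L : Xsp d m →L[ℝ] ℝ) (v : Fin d → ℝ)

theorem apply_q_eq_sum : L (v, 0, 0) = ∑ k, v k * L (Pi.single k 1, 0, 0) :=
  LinearMap.apply_eq_sum_single (L.toLinearMap ∘ₗ LinearMap.inl ℝ _ _) v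

theorem apply_p_eq_sum : L (0, v, 0) = ∑ k, v k * L (0, Pi.single k 1, 0) :=
  LinearMap.apply_eq_sum_single
    (L.toLinearMap ∘ₗ LinearMap.inr ℝ _ _ ∘ₗ LinearMap.inl ℝ _ _) v

theorem apply_zdir_eq_sum (j : Fin m) :
    L (zdir d m j v) = ∑ k, v k * L (zdir d m j (Pi.single k 1)) :=
  LinearMap.apply_eq_sum_single (L.toLinearMap ∘ₗ LinearMap.inr ℝ _ _ ∘ₗ LinearMap.inr ℝ _ _ ∘ₗ
    LinearMap.single ℝ (fun _ : Fin m => Fin d → ℝ) j) v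

end Coordinates

/-- The first order antisymmetric part of `gen`, in coordinates. -/
def transport (d m : ℕ) (lam : Fin m → ℝ) (V : (Fin d → ℝ) → ℝ) (φ : Xsp d m → ℝ)
    (x : Xsp d m) : ℝ :=
  - ∑ k, x.2.1 k * pQ d m k φ x
  + ∑ k, fderiv ℝ V x.1 (Pi.single k 1) * pP d m k φ x
  - ∑ k, (∑ j, lam j * x.2.2 j k) * pP d m k φ x
  + ∑ j, lam j * ∑ k, x.2.1 k * pZ d m j k φ x

theorem gen_eq_transport_add (d m : ℕ) (β : ℝ) (α lam : Fin m → ℝ) (V : (Fin d → ℝ) → ℝ)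
    (φ : Xsp d m → ℝ) (x : Xsp d m) :
    gen d m β α lam V φ x = transport d m lam V φ x
      + ∑ j, α j * ∑ k, (x.2.2 j k * pZ d m j k φ x - β⁻¹ * pZ d m j k (pZ d m j k φ) x) := by
  simp only [gen, transport, apply_q_eq_sum (fderiv ℝ φ x) x.2.1,
    apply_p_eq_sum (fderiv ℝ φ x) (fun i => fderiv ℝ V x.1 (Pi.single i 1)),
    apply_p_eq_sum (fderiv ℝ φ x) (∑ j, lam j • x.2.2 j),
    apply_zdir_eq_sum (fderiv ℝ φ x) x.2.1, apply_zdir_eq_sum (fderiv ℝ φ x) (x.2.2 _),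
    Finset.sum_apply, Pi.smul_apply, smul_eq_mul, Finset.sum_sub_distrib, mul_sub,
    ← Finset.mul_sum]
  simp only [pQ, pP, pZ, Finset.mul_sum, mul_left_comm]
  ring

theorem transport_mul (d m : ℕ) (lam : Fin m → ℝ) (V : (Fin d → ℝ) → ℝ) {φ ψ : Xsp d m → ℝ}
    {x : Xsp d m} (hφ : DifferentiableAt ℝ φ x) (hψ : DifferentiableAt ℝ ψ x) :
    transport d m lam V (fun y => φ y * ψ y) x
      = transport d m lam V φ x * ψ x + φ x * transport d m lam V ψ x := by
  simp only [transport, pQ, pP, pZ, fderiv_mul_apply_dir hφ hψ, mul_add, Finset.sum_add_distrib,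
    add_mul, sub_mul, mul_sub, Finset.sum_mul, neg_mul, mul_neg, Finset.mul_sum, mul_assoc,
    mul_left_comm (φ x)]
  ring

theorem perQ_snd {d m : ℕ} (f : (Fin d → ℝ) × (Fin m → Fin d → ℝ) → ℝ) :
    PerQ d m (fun x => f x.2) := fun _ _ => rfl

theorem PerV.perQ_fst {d : ℕ} (m : ℕ) {V : (Fin d → ℝ) → ℝ} (h : PerV d V) :
    PerQ d m (fun x => V x.1) := fun k x => h k x.1

theorem PerV.fderiv {d : ℕ} {V : (Fin d → ℝ) → ℝ} (h : PerV d V) (v : Fin d → ℝ) :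
    PerV d (fun q => fderiv ℝ V q v) := by
  intro k q
  have hV : (fun y => V (y + fun i => (k i : ℝ))) = V := funext fun y => h k y
  simp only
  rw [← fderiv_comp_add_right, hV]

theorem IsTest.integralZero_transport {d m : ℕ} (lam : Fin m → ℝ) {V : (Fin d → ℝ) → ℝ}
    (hV : ContDiff ℝ (⊤ : ℕ∞) V) (hVper : PerV d V) {φ : Xsp d m → ℝ} (h : IsTest d m φ) :
    IntegralZero (volX d m) (transport d m lam V φ) := by
  have hdV : ∀ k : Fin d, ContDiff ℝ (⊤ : ℕ∞) fun x : Xsp d m =>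
      _root_.fderiv ℝ V x.1 (Pi.single k 1) := fun k =>
    ((hV.fderiv_right (m := (⊤ : ℕ∞)) (by simp)).clm_apply contDiff_const).comp contDiff_fst
  refine (((IntegralZero.sum _ fun k _ => ?_).neg.add (IntegralZero.sum _ fun k _ => ?_)).sub
    (IntegralZero.sum _ fun k _ => ?_)).add
    (IntegralZero.sum _ fun j _ => (IntegralZero.sum _ fun k _ => ?_).const_mul _)
  · exact h.integralZero_mul_fderiv (c := fun x => x.2.1 k) (by fun_prop)
      (perQ_snd fun y => y.1 k) (by simp)
  · exact h.integralZero_mul_fderiv (hdV k) ((hVper.fderiv _).perQ_fst m) (by simp)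
  · exact h.integralZero_mul_fderiv (c := fun x => ∑ j, lam j * x.2.2 j k) (by fun_prop)
      (perQ_snd fun y => ∑ j, lam j * y.2 j k) (by simp)
  · exact h.integralZero_mul_fderiv (c := fun x => x.2.1 k) (by fun_prop)
      (perQ_snd fun y => y.1 k) (by simp [zdir])

/-- The Hamiltonian `V(q) + |p|²/2 + |z|²/2`. -/
def hamil (d m : ℕ) (V : (Fin d → ℝ) → ℝ) (x : Xsp d m) : ℝ :=
  V x.1 + (∑ i, (x.2.1 i) ^ 2) / 2 + (∑ j, ∑ i, (x.2.2 j i) ^ 2) / 2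

section Hamil

variable {d m : ℕ} {V : (Fin d → ℝ) → ℝ}

theorem contDiff_hamil (hV : ContDiff ℝ (⊤ : ℕ∞) V) : ContDiff ℝ (⊤ : ℕ∞) (hamil d m V) := by
  unfold hamil
  fun_prop

theorem perQ_hamil (hVper : PerV d V) : PerQ d m (hamil d m V) := fun k x => by
  simp [hamil, hVper k x.1]

theorem fderiv_hamil (hV : ContDiff ℝ (⊤ : ℕ∞) V) (x v : Xsp d m) :
    fderiv ℝ (hamil d m V) x v = fderiv ℝ V x.1 v.1 + ∑ i, x.2.1 i * v.2.1 i
      + ∑ j, ∑ i, x.2.2 j i * v.2.2 j i := by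
  have hVd : HasFDerivAt V (fderiv ℝ V x.1) (x + (0 : ℝ) • v).1 := by
    simpa using (hV.differentiable (by simp) x.1).hasFDerivAt
  have hHd : HasFDerivAt (hamil d m V) (fderiv ℝ (hamil d m V) x) (x + (0 : ℝ) • v) := by
    simpa using ((contDiff_hamil hV).differentiable (by simp) x).hasFDerivAt
  have hline : HasDerivAt (fun t : ℝ => x + t • v) v 0 := by
    simpa using ((hasDerivAt_id (0 : ℝ)).smul_const v).const_add x
  have h1 := hHd.comp_hasDerivAt (0 : ℝ) hline
  have hcoord : ∀ a b : ℝ, HasDerivAt (fun t : ℝ => (a + t * b) ^ 2) (2 * (a * b)) 0 := by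
    intro a b
    have := (((hasDerivAt_id (0 : ℝ)).mul_const b).const_add a).fun_pow 2
    simpa [mul_assoc] using this
  have hline1 : HasDerivAt (fun t : ℝ => (x + t • v).1) v.1 0 := by
    simpa using ((hasDerivAt_id (0 : ℝ)).smul_const v.1).const_add x.1
  have h2 := ((hVd.comp_hasDerivAt (0 : ℝ) hline1).add
    ((HasDerivAt.fun_sum fun i (_ : i ∈ Finset.univ) =>
      hcoord (x.2.1 i) (v.2.1 i)).div_const 2)).add
    ((HasDerivAt.fun_sum fun j (_ : j ∈ Finset.univ) =>
      HasDerivAt.fun_sum fun i (_ : i ∈ Finset.univ) =>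
        hcoord (x.2.2 j i) (v.2.2 j i)).div_const 2)
  have h3 := h1.unique h2
  rw [h3]
  simp only [← Finset.mul_sum]
  ring

theorem pZ_hamil (hV : ContDiff ℝ (⊤ : ℕ∞) V) (j : Fin m) (k : Fin d) (x : Xsp d m) :
    pZ d m j k (hamil d m V) x = x.2.2 j k := by
  rw [pZ, fderiv_hamil hV, Finset.sum_eq_single j _ (by simp)]
  · simp [zdir, Pi.single_apply]
  · intro b _ hb
    simp [zdir, Function.update_of_ne hb]

theorem transport_hamil (lam : Fin m → ℝ) (hV : ContDiff ℝ (⊤ : ℕ∞) V) (x : Xsp d m) :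
    transport d m lam V (hamil d m V) x = 0 := by
  simp only [transport, pZ_hamil hV]
  simp only [pQ, pP, fderiv_hamil hV]
  simp [Pi.single_apply, Finset.mul_sum, mul_comm, mul_left_comm]
  rw [Finset.sum_comm]
  ring

theorem fderiv_comp_hamil (hV : ContDiff ℝ (⊤ : ℕ∞) V) {w : ℝ → ℝ} (hw : ContDiff ℝ (⊤ : ℕ∞) w)
    (x v : Xsp d m) :
    fderiv ℝ (fun y => w (hamil d m V y)) x v
      = deriv w (hamil d m V x) * fderiv ℝ (hamil d m V) x v := by
  have h := ((hw.differentiable (by simp)) (hamil d m V x)).hasDerivAt.comp_hasFDerivAt x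
    ((contDiff_hamil hV).differentiable (by simp) x).hasFDerivAt
  have h' : fderiv ℝ (fun y => w (hamil d m V y)) x = _ := h.fderiv
  rw [h']
  simp

theorem transport_comp_hamil (lam : Fin m → ℝ) (hV : ContDiff ℝ (⊤ : ℕ∞) V) {w : ℝ → ℝ}
    (hw : ContDiff ℝ (⊤ : ℕ∞) w) (x : Xsp d m) :
    transport d m lam V (fun y => w (hamil d m V y)) x = 0 := by
  rw [← mul_zero (deriv w (hamil d m V x)), ← transport_hamil lam hV x]
  simp only [transport, pQ, pP, pZ, fderiv_comp_hamil hV hw, mul_add, mul_sub, mul_neg,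
    Finset.mul_sum, mul_left_comm (deriv w (hamil d m V x))]

theorem PerV.exists_bound (hV : Continuous V) (hVper : PerV d V) : ∃ C, 0 ≤ C ∧ ∀ q, -C ≤ V q := by
  obtain ⟨M, hM⟩ := (isCompact_Icc (a := (0 : Fin d → ℝ)) (b := 1)).exists_bound_of_continuousOn
    hV.continuousOn
  refine ⟨max M 0, le_max_right _ _, fun q => ?_⟩
  rw [← hVper (fun i => -⌊q i⌋) q]
  have := hM (q + fun i => ((-⌊q i⌋ : ℤ) : ℝ)) ⟨fun i => ?_, fun i => ?_⟩
  · have h2 := neg_abs_le (V (q + fun i => ((-⌊q i⌋ : ℤ) : ℝ)))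
    rw [Real.norm_eq_abs] at this
    linarith [le_max_left M 0]
  · simpa using Int.floor_le (q i)
  · have := Int.lt_floor_add_one (q i)
    simp only [Pi.add_apply, Int.cast_neg, Pi.one_apply]
    linarith

theorem sq_p_le {C : ℝ} (hC : ∀ q, -C ≤ V q) (x : Xsp d m) (k : Fin d) :
    x.2.1 k ^ 2 ≤ 2 * (hamil d m V x + C) := by
  have h1 : x.2.1 k ^ 2 ≤ ∑ i, x.2.1 i ^ 2 :=
    Finset.single_le_sum (f := fun i => x.2.1 i ^ 2) (fun i _ => sq_nonneg _) (Finset.mem_univ k)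
  have h2 : 0 ≤ ∑ j, ∑ i, x.2.2 j i ^ 2 :=
    Finset.sum_nonneg fun j _ => Finset.sum_nonneg fun i _ => sq_nonneg _
  have := hC x.1
  unfold hamil
  linarith

theorem sq_z_le {C : ℝ} (hC : ∀ q, -C ≤ V q) (x : Xsp d m) (j : Fin m) (k : Fin d) :
    x.2.2 j k ^ 2 ≤ 2 * (hamil d m V x + C) := by
  have h1 : 0 ≤ ∑ i, x.2.1 i ^ 2 := Finset.sum_nonneg fun i _ => sq_nonneg _
  have h2 : x.2.2 j k ^ 2 ≤ ∑ i, x.2.2 j i ^ 2 :=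
    Finset.single_le_sum (f := fun i => x.2.2 j i ^ 2) (fun i _ => sq_nonneg _)
      (Finset.mem_univ k)
  have h3 : ∑ i, x.2.2 j i ^ 2 ≤ ∑ j, ∑ i, x.2.2 j i ^ 2 :=
    Finset.single_le_sum (f := fun j => ∑ i, x.2.2 j i ^ 2)
      (fun j _ => Finset.sum_nonneg fun i _ => sq_nonneg _) (Finset.mem_univ j)
  have := hC x.1
  unfold hamil
  linarith

theorem isTest_comp_hamil (hV : ContDiff ℝ (⊤ : ℕ∞) V) (hVper : PerV d V) {w : ℝ → ℝ}
    (hw : ContDiff ℝ (⊤ : ℕ∞) w) {R : ℝ} (hR : ∀ h, R < h → w h = 0) :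
    IsTest d m (fun x => w (hamil d m V x)) := by
  obtain ⟨C, -, hC⟩ := hVper.exists_bound hV.continuous
  refine ⟨hw.comp (contDiff_hamil hV), fun k x => ?_,
    Metric.closedBall 0 (1 + 2 * |R + C|), isCompact_closedBall _ _, fun x hx => ?_⟩
  · simp only [perQ_hamil hVper k x]
  · apply hR
    by_contra! hle
    apply hx
    have hsq : ∀ a : ℝ, a ^ 2 ≤ 2 * (hamil d m V x + C) → ‖a‖ ≤ 1 + 2 * |R + C| := by
      intro a ha
      have h1 := le_abs_self (R + C)
      rw [Real.norm_eq_abs]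
      refine abs_le_of_sq_le_sq (by nlinarith [abs_nonneg (R + C)]) (by positivity)
    have hpos : 0 ≤ 1 + 2 * |R + C| := by positivity
    rw [mem_closedBall_zero_iff]
    refine (max_le ?_ ?_)
    · exact (pi_norm_le_iff_of_nonneg hpos).2 fun k => hsq _ (sq_p_le hC x k)
    · exact (pi_norm_le_iff_of_nonneg hpos).2 fun j =>
        (pi_norm_le_iff_of_nonneg hpos).2 fun k => hsq _ (sq_z_le hC x j k)

end Hamil

/-- The energy identity for solutions of the Poisson equation, tested against `g · w(H)` for a
cutoff profile `w` in the energy. -/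
theorem integralZero_energy_identity {d m : ℕ} {β : ℝ} (hβ : 0 < β) {α lam : Fin m → ℝ}
    {V : (Fin d → ℝ) → ℝ} (hV : ContDiff ℝ (⊤ : ℕ∞) V) (hVper : PerV d V) {i : Fin m}
    {e : Fin d → ℝ} {g : Xsp d m → ℝ} (hg : ContDiff ℝ (⊤ : ℕ∞) g) (hgper : PerQ d m g)
    (hpoisson : ∀ x, gen d m β α lam V g x = -(α i / lam i) * ∑ k, x.2.2 i k * e k)
    {w : ℝ → ℝ} (hw : ContDiff ℝ (⊤ : ℕ∞) w) {R : ℝ} (hR : ∀ h, R < h → w h = 0) :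
    IntegralZero (volX d m) fun x =>
      ∑ j, α j * ∑ k, (pZ d m j k g x ^ 2 * w (hamil d m V x) + pZ d m j k g x * g x *
        (x.2.2 j k * (β * w (hamil d m V x) + deriv w (hamil d m V x))))
      + α i / lam i * ∑ k, e k * (pZ d m i k g x * w (hamil d m V x) + g x *
        (x.2.2 i k * (β * w (hamil d m V x) + deriv w (hamil d m V x)))) := by
  have hW := isTest_comp_hamil (m := m) hV hVper hw hR
  have hgW := hW.mul_left hg hgper
  have hpZ : ∀ j k, ContDiff ℝ (⊤ : ℕ∞) (pZ d m j k g) := fun j k =>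
    (hg.fderiv_right (m := (⊤ : ℕ∞)) (by simp)).clm_apply contDiff_const
  have hT := (hgW.mul_left hg hgper).integralZero_transport lam hV hVper
  have hD : ∀ j k, IntegralZero (volX d m)
      (pZ d m j k fun y => pZ d m j k g y * (g y * w (hamil d m V y))) := fun j k =>
    have h := hgW.mul_left (hpZ j k) (hgper.fderiv _)
    ⟨(h.fderiv _).integrable, h.integral_fderiv _⟩
  have hE : ∀ k, IntegralZero (volX d m)
      (pZ d m i k fun y => g y * w (hamil d m V y)) := fun k =>
    ⟨(hgW.fderiv _).integrable, hgW.integral_fderiv _⟩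
  have key := ((hT.const_mul (-(β / 2))).add
    (IntegralZero.sum Finset.univ fun j _ =>
      (IntegralZero.sum Finset.univ fun k _ => hD j k).const_mul (α j))).add
    ((IntegralZero.sum Finset.univ fun k _ => (hE k).const_mul (e k)).const_mul (α i / lam i))
  convert key using 1
  funext x
  have hdg := hg.differentiable (by simp) x
  have hdW := hW.1.differentiable (by simp) x
  have hdgW := hgW.1.differentiable (by simp) x
  have hWz : ∀ j k, pZ d m j k (fun y => w (hamil d m V y)) x
      = deriv w (hamil d m V x) * x.2.2 j k := fun j k => by
    rw [← pZ_hamil hV j k x]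
    exact fderiv_comp_hamil hV hw x _
  have hEx : ∀ j k, pZ d m j k (fun y => g y * w (hamil d m V y)) x
      = pZ d m j k g x * w (hamil d m V x)
        + g x * (deriv w (hamil d m V x) * x.2.2 j k) := fun j k => by
    rw [← hWz]
    exact fderiv_mul_apply_dir hdg hdW _
  have hDx : ∀ j k, pZ d m j k (fun y => pZ d m j k g y * (g y * w (hamil d m V y))) x
      = pZ d m j k (pZ d m j k g) x * (g x * w (hamil d m V x))
        + pZ d m j k g x * (pZ d m j k g x * w (hamil d m V x)
        + g x * (deriv w (hamil d m V x) * x.2.2 j k)) := fun j k => by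
    rw [← hEx]
    exact fderiv_mul_apply_dir ((hpZ j k).differentiable (by simp) x) hdgW _
  have hTx : transport d m lam V (fun y => g y * (g y * w (hamil d m V y))) x
      = 2 * (g x * w (hamil d m V x)) * transport d m lam V g x := by
    rw [transport_mul d m lam V hdg hdgW, transport_mul d m lam V hdg hdW,
      transport_comp_hamil lam hV hw]
    ring
  have hp := hpoisson x
  rw [gen_eq_transport_add] at hp
  have h1 : ∑ j, α j * ∑ k, (pZ d m j k g x ^ 2 * w (hamil d m V x) + pZ d m j k g x * g x *
        (x.2.2 j k * (β * w (hamil d m V x) + deriv w (hamil d m V x))))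
      = β * (g x * w (hamil d m V x)) * (∑ j, α j * ∑ k,
          (x.2.2 j k * pZ d m j k g x - β⁻¹ * pZ d m j k (pZ d m j k g) x))
        + ∑ j, α j * ∑ k,
          pZ d m j k (fun y => pZ d m j k g y * (g y * w (hamil d m V y))) x := by
    rw [Finset.mul_sum, ← Finset.sum_add_distrib]
    refine Finset.sum_congr rfl fun j _ => ?_
    rw [mul_left_comm, ← mul_add]
    congr 1
    rw [Finset.mul_sum, ← Finset.sum_add_distrib]
    refine Finset.sum_congr rfl fun k _ => ?_
    rw [hDx]
    field_simp
    ring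
  have h2 : ∑ k, e k * (pZ d m i k g x * w (hamil d m V x) + g x *
        (x.2.2 i k * (β * w (hamil d m V x) + deriv w (hamil d m V x))))
      = β * (g x * w (hamil d m V x)) * (∑ k, x.2.2 i k * e k)
        + ∑ k, e k * pZ d m i k (fun y => g y * w (hamil d m V y)) x := by
    rw [Finset.mul_sum, ← Finset.sum_add_distrib]
    refine Finset.sum_congr rfl fun k _ => ?_
    rw [hEx]
    ring
  rw [h1, h2, hTx]
  linear_combination β * (g x * w (hamil d m V x)) * hp

theorem exists_cutoff : ∃ (ψ : ℝ → ℝ) (D : ℝ), ContDiff ℝ (⊤ : ℕ∞) ψ ∧ ψ 0 = 1 ∧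
    (∀ s, |ψ s| ≤ 1) ∧ (∀ s, 2 < s → ψ s = 0) ∧ (∀ s, |deriv ψ s| ≤ D) ∧
    ∀ s, 2 < s → deriv ψ s = 0 := by
  let b : ContDiffBump (0 : ℝ) := ⟨1, 2, one_pos, one_lt_two⟩
  have hzero : ∀ s, 2 < s → b s = 0 := fun s hs => b.zero_of_le_dist (by
    simpa [b] using hs.le.trans (le_abs_self s))
  obtain ⟨D, hD⟩ := b.hasCompactSupport.deriv.exists_bound_of_continuous
    ((b.contDiff (n := 1)).continuous_deriv le_rfl)
  refine ⟨b, D, b.contDiff, b.one_of_mem_closedBall (by simp [b]), fun s => ?_, hzero, hD,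
    fun s hs => ?_⟩
  · rw [abs_of_nonneg b.nonneg]
    exact b.le_one
  · have hev : b =ᶠ[nhds s] fun _ => (0 : ℝ) := by
      filter_upwards [lt_mem_nhds hs] with t ht using hzero t ht
    simp [hev.deriv_eq]

/-- The functions `F n` are integrable, with integrals converging to `l`. -/
def IntegralTendsto {X : Type*} [MeasurableSpace X] (μ : Measure X) (F : ℕ → X → ℝ) (l : ℝ) :
    Prop :=
  (∀ n, Integrable (F n) μ) ∧ Tendsto (fun n => ∫ x, F n x ∂μ) atTop (nhds l)

namespace IntegralTendsto

variable {X : Type*} [MeasurableSpace X] {μ : Measure X} {F G : ℕ → X → ℝ} {l l' : ℝ}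

theorem add (hF : IntegralTendsto μ F l) (hG : IntegralTendsto μ G l') :
    IntegralTendsto μ (fun n x => F n x + G n x) (l + l') :=
  ⟨fun n => (hF.1 n).add (hG.1 n), by
    simpa only [integral_add (hF.1 _) (hG.1 _)] using hF.2.add hG.2⟩

theorem const_mul (hF : IntegralTendsto μ F l) (c : ℝ) :
    IntegralTendsto μ (fun n x => c * F n x) (c * l) :=
  ⟨fun n => (hF.1 n).const_mul c, by
    simpa only [integral_const_mul] using hF.2.const_mul c⟩

theorem sum {ι : Type*} (s : Finset ι) {F : ι → ℕ → X → ℝ} {l : ι → ℝ}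
    (h : ∀ i ∈ s, IntegralTendsto μ (F i) (l i)) :
    IntegralTendsto μ (fun n x => ∑ i ∈ s, F i n x) (∑ i ∈ s, l i) :=
  ⟨fun n => integrable_finsetSum s fun i hi => (h i hi).1 n, by
    simpa only [integral_finsetSum s fun i hi => (h i hi).1 _] using
      tendsto_finsetSum s fun i hi => (h i hi).2⟩

theorem mul_of_bounded {f : X → ℝ} (hf : Integrable f μ) {c : ℕ → X → ℝ} {a M : ℝ}
    (hc : ∀ n, AEStronglyMeasurable (c n) μ) (hM : ∀ n x, |c n x| ≤ M)
    (hlim : ∀ x, Tendsto (fun n => c n x) atTop (nhds a)) :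
    IntegralTendsto μ (fun n x => f x * c n x) (a * ∫ x, f x ∂μ) := by
  refine ⟨fun n => hf.mul_bdd (hc n) (Eventually.of_forall (hM n)), ?_⟩
  have h : a * ∫ x, f x ∂μ = ∫ x, f x * a ∂μ := by rw [integral_mul_const, mul_comm]
  rw [h]
  refine tendsto_integral_of_dominated_convergence (fun x => |f x| * M)
    (fun n => hf.aestronglyMeasurable.mul (hc n)) (hf.abs.mul_const M)
    (fun n => Eventually.of_forall fun x => ?_)
    (Eventually.of_forall fun x => (hlim x).const_mul (f x))
  rw [Real.norm_eq_abs, abs_mul]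
  exact mul_le_mul_of_nonneg_left (hM n x) (abs_nonneg _)

end IntegralTendsto

theorem abs_coord_mul_cutoff_deriv_le {d m : ℕ} {V : (Fin d → ℝ) → ℝ} {C D : ℝ} (hC0 : 0 ≤ C)
    (hC : ∀ q, -C ≤ V q) {ψ' : ℝ → ℝ} (hD : ∀ s, |ψ' s| ≤ D) (h0 : ∀ s, 2 < s → ψ' s = 0)
    (n : ℕ) (x : Xsp d m) (j : Fin m) (k : Fin d) :
    |x.2.2 j k * (ψ' (hamil d m V x / (n + 1)) / (n + 1))| ≤ (5 + 2 * C) * D := by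
  have hn : (1 : ℝ) ≤ n + 1 := by linarith [(Nat.cast_nonneg n : (0 : ℝ) ≤ n)]
  have hn0 : (0 : ℝ) < n + 1 := by linarith
  have hD0 : 0 ≤ D := (abs_nonneg _).trans (hD 0)
  rcases lt_or_ge 2 (hamil d m V x / (n + 1)) with h | h
  · rw [h0 _ h]
    simp only [zero_div, mul_zero, abs_zero]
    positivity
  · rw [div_le_iff₀ hn0] at h
    have hz := sq_z_le hC x j k
    have hz' : |x.2.2 j k| ≤ (5 + 2 * C) * (n + 1) := by
      refine abs_le_of_sq_le_sq ?_ (by positivity)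
      have hA : 1 ≤ (5 + 2 * C) * ((n : ℝ) + 1) := by nlinarith
      have hzA : x.2.2 j k ^ 2 ≤ (5 + 2 * C) * ((n : ℝ) + 1) := by nlinarith
      exact hzA.trans (le_self_pow₀ hA two_ne_zero)
    rw [mul_div_assoc', abs_div, abs_of_pos hn0, div_le_iff₀ hn0, abs_mul]
    calc |x.2.2 j k| * |ψ' (hamil d m V x / (n + 1))| ≤ (5 + 2 * C) * (n + 1) * D :=
          mul_le_mul hz' (hD _) (abs_nonneg _) (by positivity)
      _ = (5 + 2 * C) * D * (n + 1) := by ring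

theorem integral_gibbs (d m : ℕ) {β Z : ℝ} (hZ : 0 < Z) {V : (Fin d → ℝ) → ℝ}
    (hV : Continuous V) (f : Xsp d m → ℝ) :
    ∫ x, f x ∂(gibbs d m β Z V) = Z⁻¹ * ∫ x, f x * gdens d m β V x ∂(volX d m) := by
  have hc : Continuous (gdens d m β V) := by
    unfold gdens
    fun_prop
  rw [gibbs, integral_withDensity_eq_integral_toReal_smul
    (hc.const_mul Z⁻¹).measurable.ennreal_ofReal
    (Eventually.of_forall fun x => ENNReal.ofReal_lt_top), ← integral_const_mul]
  refine integral_congr_ae (Eventually.of_forall fun x => ?_)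
  have h0 : 0 ≤ Z⁻¹ * gdens d m β V x :=
    mul_nonneg (inv_nonneg.2 hZ.le) (Real.exp_pos _).le
  simp only [ENNReal.toReal_ofReal h0, smul_eq_mul]
  ring

theorem integrable_mul_of_sq {X : Type*} [MeasurableSpace X] {μ : Measure X} {f h : X → ℝ}
    (hf : AEStronglyMeasurable f μ) (hh : AEStronglyMeasurable h μ)
    (hf2 : Integrable (fun x => f x ^ 2) μ) (hh2 : Integrable (fun x => h x ^ 2) μ) :
    Integrable (fun x => f x * h x) μ :=
  ((memLp_two_iff_integrable_sq hf).2 hf2).integrable_mul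
    ((memLp_two_iff_integrable_sq hh).2 hh2)

/-- The energy identity `Σ_j α_j ‖∇_{z_j} g‖² = -(α_i/λ_i) ∫ e·∇_{z_i} g dμ_β`. -/
theorem gibbs_energy_identity {d m : ℕ} {β : ℝ} (hβ : 0 < β) {α lam : Fin m → ℝ}
    {V : (Fin d → ℝ) → ℝ} (hV : ContDiff ℝ (⊤ : ℕ∞) V) (hVper : PerV d V) {Z : ℝ} (hZ : 0 < Z)
    {i : Fin m} {e : Fin d → ℝ} {g : Xsp d m → ℝ} (hg : ContDiff ℝ (⊤ : ℕ∞) g)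
    (hgper : PerQ d m g)
    (hpoisson : ∀ x, gen d m β α lam V g x = -(α i / lam i) * ∑ k, x.2.2 i k * e k)
    (hi : Integrable g (gibbs d m β Z V))
    (hi1 : ∀ k, Integrable (pZ d m i k g) (gibbs d m β Z V))
    (hi2 : ∀ j k, Integrable (fun x => pZ d m j k g x ^ 2) (gibbs d m β Z V))
    (hi3 : ∀ j k, Integrable (fun x => pZ d m j k g x * g x) (gibbs d m β Z V)) :
    ∑ j, α j * ∑ k, ∫ x, pZ d m j k g x ^ 2 ∂(gibbs d m β Z V)
      + α i / lam i * ∑ k, e k * ∫ x, pZ d m i k g x ∂(gibbs d m β Z V) = 0 := by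
  obtain ⟨ψ, D, hψ, hψ0, hψ1, hψR, hψD, hψR'⟩ := exists_cutoff
  obtain ⟨C, hC0, hC⟩ := hVper.exists_bound hV.continuous
  have hH := contDiff_hamil (m := m) hV
  have hHc := hH.continuous
  have hψ'c : Continuous (deriv ψ) := hψ.continuous_deriv (by simp)
  set μ := gibbs d m β Z V
  have hs : ∀ x, Tendsto (fun n : ℕ => hamil d m V x / ((n : ℝ) + 1)) atTop (nhds 0) := fun x => by
    simpa [div_eq_mul_inv] using tendsto_one_div_add_atTop_nhds_zero_nat.const_mul (hamil d m V x)
  have hA : ∀ {f : Xsp d m → ℝ}, Integrable f μ →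
      IntegralTendsto μ (fun (n : ℕ) x => f x * ψ (hamil d m V x / (n + 1))) (∫ x, f x ∂μ) := by
    intro f hf
    rw [← one_mul (∫ x, f x ∂μ)]
    refine IntegralTendsto.mul_of_bounded hf
      (fun n => (hψ.continuous.comp (hHc.div_const _)).aestronglyMeasurable)
      (fun n x => hψ1 _) fun x => ?_
    have := (hψ.continuous.tendsto 0).comp (hs x)
    rwa [hψ0] at this
  have hB : ∀ {f : Xsp d m → ℝ} (j k), Integrable f μ →
      IntegralTendsto μ (fun (n : ℕ) x => f x *
        (x.2.2 j k * (deriv ψ (hamil d m V x / (n + 1)) / (n + 1)))) 0 := by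
    intro f j k hf
    rw [← zero_mul (∫ x, f x ∂μ)]
    refine IntegralTendsto.mul_of_bounded hf (fun n => ?_)
      (abs_coord_mul_cutoff_deriv_le hC0 hC hψD hψR' · · j k) fun x => ?_
    · exact Continuous.aestronglyMeasurable (by fun_prop)
    · have h1 := (hψ'c.tendsto 0).comp (hs x)
      have h2 := (h1.mul tendsto_one_div_add_atTop_nhds_zero_nat).const_mul (x.2.2 j k)
      simpa [div_eq_mul_inv] using h2
  have hlim := (IntegralTendsto.sum Finset.univ fun j _ => (IntegralTendsto.sum Finset.univ
      fun k _ => (hA (hi2 j k)).add (hB j k (hi3 j k))).const_mul (α j)).add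
    ((IntegralTendsto.sum Finset.univ
      fun k _ => ((hA (hi1 k)).add (hB i k hi)).const_mul (e k)).const_mul (α i / lam i))
  simp only [add_zero] at hlim
  refine tendsto_nhds_unique hlim.2 (tendsto_const_nhds.congr fun n => Eq.symm ?_)
  have hn0 : (0 : ℝ) < n + 1 := by positivity
  have hw : ContDiff ℝ (⊤ : ℕ∞) fun h : ℝ => ψ (h / (n + 1)) * Real.exp (-β * h) := by fun_prop
  have hw' : ∀ h : ℝ, deriv (fun h : ℝ => ψ (h / (n + 1)) * Real.exp (-β * h)) h
      = deriv ψ (h / (n + 1)) / (n + 1) * Real.exp (-β * h)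
        - β * (ψ (h / (n + 1)) * Real.exp (-β * h)) := by
    intro h
    have h1 : HasDerivAt (fun h : ℝ => ψ (h / (n + 1)))
        (deriv ψ (h / (n + 1)) * (1 / (n + 1))) h :=
      ((hψ.differentiable (by simp)) _).hasDerivAt.comp h ((hasDerivAt_id h).div_const _)
    have h2 : HasDerivAt (fun h : ℝ => Real.exp (-β * h)) (Real.exp (-β * h) * (-β * 1)) h :=
      ((hasDerivAt_id h).const_mul (-β)).exp
    rw [(h1.fun_mul h2).deriv]
    ring
  have hid := integralZero_energy_identity hβ hV hVper hg hgper hpoisson hw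
    (R := 2 * (n + 1)) fun h hh => by
      rw [hψR _ ((lt_div_iff₀ hn0).2 hh), zero_mul]
  rw [integral_gibbs d m hZ hV.continuous, mul_eq_zero]
  right
  rw [← hid.2]
  refine integral_congr_ae (Eventually.of_forall fun x => ?_)
  have hρ : gdens d m β V x = Real.exp (-β * hamil d m V x) := rfl
  simp only [hw', hρ, add_mul, Finset.sum_mul, mul_assoc]
  congr 1
  · refine Finset.sum_congr rfl fun j _ => ?_
    congr 1
    refine Finset.sum_congr rfl fun k _ => ?_
    ring
  · congr 1
    refine Finset.sum_congr rfl fun k _ => ?_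
    ring

/-- (Key a priori estimate for the corrector.) Assume `V ∈ C^∞(𝕋^d)`,
fix `i` and a unit vector `e`, and let `g` (smooth, with all derivatives in `L²(μ_β)`)
solve `𝓛g = −(α_i/λ_i) z_i·e`. Then `‖∇_{z_i} g‖_{L²(μ_β)} ≤ 1/λ_i`. -/
theorem corrector_estimate
    (d m : ℕ) (hd : 1 ≤ d) (hm : 1 ≤ m)
    (β : ℝ) (hβ : 0 < β)
    (α lam : Fin m → ℝ) (hα : ∀ j, 0 < α j) (hlam : ∀ j, 0 < lam j)
    (V : (Fin d → ℝ) → ℝ) (hV : ContDiff ℝ (⊤ : ℕ∞) V) (hVper : PerV d V)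
    (Z : ℝ) (hZ : 0 < Z)
    (hprob : IsProbabilityMeasure (gibbs d m β Z V))
    (i : Fin m)
    (e : Fin d → ℝ) (he : ∑ k, (e k) ^ 2 = 1)
    (g : Xsp d m → ℝ) (hg : ContDiff ℝ (⊤ : ℕ∞) g) (hgper : PerQ d m g)
    (hgL2 : ∀ (n : ℕ) (v : Fin n → Xsp d m),
      Integrable (fun x => (iteratedFDeriv ℝ n g x v) ^ 2) (gibbs d m β Z V))
    (hpoisson : ∀ x, gen d m β α lam V g x = -(α i / lam i) * ∑ k, x.2.2 i k * e k) :
    Real.sqrt (∫ x, ∑ k, (pZ d m i k g x) ^ 2 ∂(gibbs d m β Z V)) ≤ 1 / lam i := by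
  set μ := gibbs d m β Z V
  have hpZ : ∀ j k, Continuous (pZ d m j k g) := fun j k =>
    ((hg.fderiv_right (m := (⊤ : ℕ∞)) (by simp)).clm_apply contDiff_const).continuous
  have hg2 : Integrable (fun x => g x ^ 2) μ := by
    simpa using hgL2 0 ![]
  have hi2 : ∀ j k, Integrable (fun x => pZ d m j k g x ^ 2) μ := fun j k => by
    simpa [iteratedFDeriv_one_apply, pZ] using hgL2 1 ![zdir d m j (Pi.single k 1)]
  have hgm : AEStronglyMeasurable g μ := hg.continuous.aestronglyMeasurable
  have hpm : ∀ j k, AEStronglyMeasurable (pZ d m j k g) μ := fun j k =>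
    (hpZ j k).aestronglyMeasurable
  have hi : Integrable g μ := ((memLp_two_iff_integrable_sq hgm).2 hg2).integrable one_le_two
  have hi1 : ∀ j k, Integrable (pZ d m j k g) μ := fun j k =>
    ((memLp_two_iff_integrable_sq (hpm j k)).2 (hi2 j k)).integrable one_le_two
  have hid := gibbs_energy_identity hβ hV hVper hZ hg hgper hpoisson hi (hi1 i) hi2
    fun j k => integrable_mul_of_sq (hpm j k) hgm (hi2 j k) hg2
  have hN : ∀ j k, 0 ≤ ∫ x, pZ d m j k g x ^ 2 ∂μ := fun j k =>
    integral_nonneg fun x => sq_nonneg _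
  have hsq : ∀ k, 0 ≤ ∫ x, pZ d m i k g x ^ 2 ∂μ + 2 / lam i * (e k * ∫ x, pZ d m i k g x ∂μ)
      + (1 / lam i) ^ 2 * e k ^ 2 := fun k => by
    have h : 0 ≤ ∫ x, (pZ d m i k g x + e k / lam i) ^ 2 ∂μ := integral_nonneg fun x => sq_nonneg _
    have heq : (fun x => (pZ d m i k g x + e k / lam i) ^ 2) = fun x =>
        pZ d m i k g x ^ 2 + (2 * (e k / lam i)) * pZ d m i k g x + (e k / lam i) ^ 2 := by
      funext x
      ring
    have hsplit : Integrable (fun x => pZ d m i k g x ^ 2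
        + (2 * (e k / lam i)) * pZ d m i k g x) μ := (hi2 i k).add ((hi1 i k).const_mul _)
    rw [heq, integral_add hsplit (integrable_const _),
      integral_add (hi2 i k) ((hi1 i k).const_mul _), integral_const_mul] at h
    simp only [integral_const, probReal_univ, one_smul] at h
    convert h using 1
    ring
  have hsum := Finset.sum_nonneg fun k (_ : k ∈ Finset.univ) => hsq k
  rw [Finset.sum_add_distrib, Finset.sum_add_distrib, ← Finset.mul_sum, ← Finset.mul_sum, he]
    at hsum
  have hge : α i * ∑ k, ∫ x, pZ d m i k g x ^ 2 ∂μ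
      ≤ ∑ j, α j * ∑ k, ∫ x, pZ d m j k g x ^ 2 ∂μ :=
    Finset.single_le_sum (f := fun j => α j * ∑ k, ∫ x, pZ d m j k g x ^ 2 ∂μ)
      (fun j _ => mul_nonneg (hα j).le (Finset.sum_nonneg fun k _ => hN j k)) (Finset.mem_univ i)
  have hle : α i * (∑ k, ∫ x, pZ d m i k g x ^ 2 ∂μ
      + 1 / lam i * ∑ k, e k * ∫ x, pZ d m i k g x ∂μ) ≤ 0 := by
    calc _ = α i * ∑ k, ∫ x, pZ d m i k g x ^ 2 ∂μ
          + α i / lam i * ∑ k, e k * ∫ x, pZ d m i k g x ∂μ := by ring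
      _ ≤ 0 := by linarith
  have hle' := nonpos_of_mul_nonpos_right hle (hα i)
  rw [integral_finsetSum _ fun k _ => hi2 i k]
  refine Real.sqrt_le_iff.2 ⟨(one_div_pos.2 (hlam i)).le, ?_⟩
  have h2 : 2 / lam i * ∑ k, e k * ∫ x, pZ d m i k g x ∂μ
      = 2 * (1 / lam i * ∑ k, e k * ∫ x, pZ d m i k g x ∂μ) := by ring
  linarith
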